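/- arXiv:1601.06991 — 2 statements merged into one kernel-verified Lean document; each statement's English description precedes it below -/
import Mathlib

section
/- Let n ≥ 1 be an integer, 0 < q < 1, and let π have the Mallows distribution μ_{n,q}. Let 0 ≤ t < n and let g ⊆ {1,…,t}² be any set with P[Γ_π ∩ ({1,…,t}×{1,…,t}) = g] > 0. Call j ∈ {1,…,t} a free column value of g if g contains no point with second coordinate j, and call i ∈ {1,…,t} a free row index of g if g contains no point with first coordinate i. Then, conditionally on {Γ_π ∩ ({1,…,t}×{1,…,t}) = g}: (a) for every free column value j, P[π(t+1) = j] = q^{k−1}·(1−q)/(1−q^{n−t}), where k := |{j' ≤ j : j' is a free column value of g}|; (b) for every free row index i, P[π(i) = t+1] = q^{k'−1}·(1−q)/(1−q^{n−t}), where k' := |{i' ≤ i : i' is a free row index of g}|; and (c) for every free row index i and free column value j, the events {π(i) = t+1} and {π(t+1) = j} are conditionally independent: P[π(i)=t+1 and π(t+1)=j] = P[π(i)=t+1]·P[π(t+1)=j] (all probabilities conditional on the given event). -/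
open Finset
open scoped Classical BigOperators

noncomputable section

/-- Number of inversions of a permutation of `Fin n` (0-indexed positions). -/
def invCount (n : ℕ) (π : Equiv.Perm (Fin n)) : ℕ :=
  ((Finset.univ : Finset (Fin n × Fin n)).filter
    (fun p => p.1 < p.2 ∧ π p.2 < π p.1)).card

/-- Normalizing constant of the Mallows distribution. -/
def mallowsZ (n : ℕ) (q : ℝ) : ℝ :=
  ∑ σ : Equiv.Perm (Fin n), q ^ invCount n σ

/-- Mallows probability of an individual permutation. -/
def mallowsP (n : ℕ) (q : ℝ) (π : Equiv.Perm (Fin n)) : ℝ :=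
  q ^ invCount n π / mallowsZ n q

/-- Expectation of a real-valued functional under the Mallows distribution. -/
def mExp (n : ℕ) (q : ℝ) (X : Equiv.Perm (Fin n) → ℝ) : ℝ :=
  ∑ π : Equiv.Perm (Fin n), mallowsP n q π * X π

/-- Probability of an event under the Mallows distribution. -/
def mProb (n : ℕ) (q : ℝ) (A : Equiv.Perm (Fin n) → Prop) : ℝ :=
  ∑ π : Equiv.Perm (Fin n), if A π then mallowsP n q π else 0

/-- Conditional probability of `A` given `B` under the Mallows distribution. -/
def mCondProb (n : ℕ) (q : ℝ) (A B : Equiv.Perm (Fin n) → Prop) : ℝ :=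
  mProb n q (fun π => A π ∧ B π) / mProb n q B

/-- The graph `Γ_π = {(s, π(s))}` of a permutation, as a subset of `Fin n × Fin n`. -/
def graphP (n : ℕ) (π : Equiv.Perm (Fin n)) : Finset (Fin n × Fin n) :=
  Finset.univ.filter (fun p => π p.1 = p.2)

/-- `a < b`, `π a < π b`, and no position after `a` has value strictly in between. -/
def StepAt {n : ℕ} (π : Equiv.Perm (Fin n)) (a b : Fin n) : Prop :=
  a < b ∧ π a < π b ∧ ∀ c, a < c → π a < π c → ¬ π c < π b

/-- Number of later-or-equal positions with smaller value. -/
def rk {n : ℕ} (a : Fin n) (π : Equiv.Perm (Fin n)) : ℕ :=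
  ((Finset.univ : Finset (Fin n)).filter (fun c => a ≤ c ∧ π c < π a)).card

lemma swap_le_iff {n : ℕ} {a b : Fin n} (hab : a < b) (p c : Fin n) (hp : p < a) :
    p < Equiv.swap a b c ↔ p < c := by
  rw [Equiv.swap_apply_def]
  split_ifs with h1 h2
  · subst h1; exact ⟨fun _ => hp, fun _ => hp.trans hab⟩
  · subst h2; exact ⟨fun _ => hp.trans hab, fun _ => hp⟩
  · rfl

lemma step_inv {n : ℕ} (π : Equiv.Perm (Fin n)) (a b : Fin n) (h : StepAt π a b) :
    invCount n (π * Equiv.swap a b) = invCount n π + 1 := by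
  obtain ⟨hab, hv, hno⟩ := h
  unfold invCount
  set φ : Fin n × Fin n → Fin n × Fin n :=
    fun p => if p.1 < a then (p.1, Equiv.swap a b p.2) else p with hφ
  have hφφ : ∀ p, φ (φ p) = p := by
    intro p
    by_cases hp : p.1 < a <;> simp [hφ, hp]
  have hcmp : ∀ c d, a ≤ c → c < d → (c, d) ≠ (a, b) →
      (π (Equiv.swap a b d) < π (Equiv.swap a b c) ↔ π d < π c) := by
    intro c d hac hcd hne
    have hda : d ≠ a := (lt_of_le_of_lt hac hcd).ne'
    have had : a < d := lt_of_le_of_lt hac hcd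
    have key : ∀ x, a < x → x ≠ b → (π x < π b ↔ π x < π a) := by
      intro x hx hxb
      constructor
      · intro hlt
        by_contra hcon
        have : π x ≠ π a := fun e => hx.ne' (π.injective e)
        exact hno x hx (lt_of_le_of_ne (not_lt.mp hcon) this.symm) hlt
      · intro hlt; exact hlt.trans hv
    have key' : ∀ x, a < x → x ≠ b → (π b < π x ↔ π a < π x) := by
      intro x hx hxb
      have e1 : π x ≠ π a := fun e => hx.ne' (π.injective e)
      have e2 : π x ≠ π b := fun e => hxb (π.injective e)
      have := key x hx hxb
      constructor
      · intro hh; exact hv.trans hh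
      · intro hh
        by_contra hcon
        exact lt_asymm hh (this.mp (lt_of_le_of_ne (not_lt.mp hcon) e2))
    by_cases hca : c = a
    · subst hca
      have hdb : d ≠ b := fun e => hne (by rw [e])
      rw [Equiv.swap_apply_left, Equiv.swap_apply_of_ne_of_ne hda hdb]
      exact key d had hdb
    · have hac' : a < c := lt_of_le_of_ne hac (Ne.symm hca)
      by_cases hcb : c = b
      · subst hcb
        rw [Equiv.swap_apply_right, Equiv.swap_apply_of_ne_of_ne hda hcd.ne']
        exact (key d had hcd.ne').symm
      · rw [Equiv.swap_apply_of_ne_of_ne hca hcb]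
        by_cases hdb : d = b
        · subst hdb
          rw [Equiv.swap_apply_right]
          exact (key' c hac' hcb).symm
        · rw [Equiv.swap_apply_of_ne_of_ne hda hdb]
  have himg : (Finset.univ.filter
      (fun p : Fin n × Fin n => p.1 < p.2 ∧ (π * Equiv.swap a b) p.2 < (π * Equiv.swap a b) p.1))
      = insert (a, b) ((Finset.univ.filter
      (fun p : Fin n × Fin n => p.1 < p.2 ∧ π p.2 < π p.1)).image φ) := by
    ext ⟨c, d⟩
    rw [Finset.mem_insert, Finset.mem_image, Finset.mem_filter]
    simp only [Finset.mem_filter, Finset.mem_univ, true_and, Equiv.Perm.mul_apply]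
    have hex : (∃ p : Fin n × Fin n, (p.1 < p.2 ∧ π p.2 < π p.1) ∧ φ p = (c, d)) ↔
        ((φ (c, d)).1 < (φ (c, d)).2 ∧ π (φ (c, d)).2 < π (φ (c, d)).1) := by
      constructor
      · rintro ⟨p, hp, he⟩
        rw [← he, hφφ]; exact hp
      · intro hp; exact ⟨_, hp, hφφ _⟩
    rw [hex]
    by_cases he : (c, d) = (a, b)
    · have h1 : c = a := congrArg Prod.fst he
      have h2 : d = b := congrArg Prod.snd he
      subst h1; subst h2
      simp [hab, hv]
    · simp only [he, false_or]
      by_cases hc : c < a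
      · have hc1 : Equiv.swap a b c = c :=
          Equiv.swap_apply_of_ne_of_ne hc.ne (hc.trans hab).ne
        simp only [hφ, hc, if_true, hc1, swap_le_iff hab c d hc]
      · simp only [hφ, hc, if_false]
        constructor
        · rintro ⟨x, y⟩
          exact ⟨x, (hcmp c d (not_lt.mp hc) x he).mp y⟩
        · rintro ⟨x, y⟩
          exact ⟨x, (hcmp c d (not_lt.mp hc) x he).mpr y⟩
  have hinj : Function.Injective φ := Function.LeftInverse.injective hφφ
  rw [himg, Finset.card_insert_of_notMem, Finset.card_image_of_injective _ hinj]
  intro hmem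
  obtain ⟨p, hp, he⟩ := Finset.mem_image.mp hmem
  have : p = (a, b) := by
    rw [← hφφ p, he]; simp [hφ]
  subst this
  simp only [Finset.mem_filter] at hp
  exact lt_asymm hv hp.2.2

lemma step_rk {n : ℕ} (π : Equiv.Perm (Fin n)) (a b : Fin n) (h : StepAt π a b) :
    rk a (π * Equiv.swap a b) = rk a π + 1 := by
  obtain ⟨hab, hv, hno⟩ := h
  unfold rk
  rw [← Finset.card_insert_of_notMem (a := b) (s := Finset.univ.filter
    (fun c => a ≤ c ∧ π c < π a)) (by simp [hv.le])]
  congr 1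
  ext c
  simp only [Finset.mem_filter, Finset.mem_univ, true_and, Finset.mem_insert,
      Equiv.Perm.mul_apply, Equiv.swap_apply_left]
  by_cases hca : c = a
  · subst hca; simp [hab.ne]
  by_cases hcb : c = b
  · subst hcb; simp [hab.le, hv]
  rw [Equiv.swap_apply_of_ne_of_ne hca hcb]
  simp only [hcb, false_or]
  constructor
  · rintro ⟨h1, h2⟩
    refine ⟨h1, ?_⟩
    have hac : a < c := lt_of_le_of_ne h1 (Ne.symm hca)
    by_contra hcon
    have : π c ≠ π a := fun e => hca (π.injective e)
    exact hno c hac (lt_of_le_of_ne (not_lt.mp hcon) this.symm) h2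
  · rintro ⟨h1, h2⟩
    exact ⟨h1, h2.trans hv⟩

lemma card_gt {n : ℕ} (a : Fin n) :
    ((Finset.univ : Finset (Fin n)).filter (fun c => a < c)).card = n - 1 - a := by
  rw [← Fin.card_Ioi a]; congr 1; ext c; simp

lemma rk_lt {n : ℕ} (π : Equiv.Perm (Fin n)) (a : Fin n) : rk a π < n - a := by
  have : rk a π ≤ n - 1 - a := by
    rw [← card_gt a]
    apply Finset.card_le_card
    intro c
    simp only [Finset.mem_filter, Finset.mem_univ, true_and]
    rintro ⟨h1, h2⟩
    exact lt_of_le_of_ne h1 (fun e => by subst e; exact lt_irrefl _ h2)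
  have := a.2
  omega

lemma exists_up {n : ℕ} (π : Equiv.Perm (Fin n)) (a : Fin n) (h : rk a π + 1 < n - a) :
    ∃ b, StepAt π a b := by
  have hne : ((Finset.univ : Finset (Fin n)).filter (fun c => a < c ∧ π a < π c)).Nonempty := by
    by_contra hemp
    rw [Finset.not_nonempty_iff_eq_empty, Finset.filter_eq_empty_iff] at hemp
    have : n - 1 - a ≤ rk a π := by
      rw [← card_gt a]
      apply Finset.card_le_card
      intro c
      simp only [Finset.mem_filter, Finset.mem_univ, true_and]
      intro hc
      refine ⟨hc.le, ?_⟩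
      have h1 : ¬ π a < π c := fun h2 => hemp (Finset.mem_univ c) ⟨hc, h2⟩
      exact lt_of_le_of_ne (not_lt.mp h1) (fun e => hc.ne' (π.injective e))
    omega
  obtain ⟨b, hb, hmin⟩ := Finset.exists_min_image _ (fun c => π c) hne
  simp only [Finset.mem_filter, Finset.mem_univ, true_and] at hb hmin
  exact ⟨b, hb.1, hb.2, fun c h1 h2 h3 => absurd (hmin c ⟨h1, h2⟩) (not_le.mpr h3)⟩

lemma exists_down {n : ℕ} (σ : Equiv.Perm (Fin n)) (a : Fin n) (h : 0 < rk a σ) :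
    ∃ b, StepAt (σ * Equiv.swap a b) a b := by
  obtain ⟨b, hb, hmax⟩ := Finset.exists_max_image _ (fun c => σ c) (Finset.card_pos.mp h)
  simp only [Finset.mem_filter, Finset.mem_univ, true_and] at hb hmax
  have hab : a < b := lt_of_le_of_ne hb.1 (fun e => by subst e; exact lt_irrefl _ hb.2)
  refine ⟨b, hab, by simpa using hb.2, ?_⟩
  intro c h1 h2 h3
  simp only [Equiv.Perm.mul_apply, Equiv.swap_apply_left, Equiv.swap_apply_right] at h2 h3
  by_cases hcb : c = b
  · subst hcb; simp at h3
  · rw [Equiv.swap_apply_of_ne_of_ne h1.ne' hcb] at h2 h3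
    exact absurd (hmax c ⟨h1.le, h3⟩) (not_le.mpr h2)

lemma step_inj {n : ℕ} (π π' : Equiv.Perm (Fin n)) (a b b' : Fin n)
    (h : StepAt π a b) (h' : StepAt π' a b')
    (he : π * Equiv.swap a b = π' * Equiv.swap a b') : b = b' := by
  have aux : ∀ (π π' : Equiv.Perm (Fin n)) (b b' : Fin n), StepAt π a b → StepAt π' a b' →
      π * Equiv.swap a b = π' * Equiv.swap a b' → ¬ π a < π' a := by
    intro π π' b b' h h' he hlt
    have e1 : π b = π' b' := by
      have := congrArg (fun f => f a) he
      simpa using this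
    have e2 : π (Equiv.swap a b b') = π' a := by
      have := congrArg (fun f => f b') he
      simpa using this
    have hbb : b' ≠ b := by
      intro e; subst e
      rw [Equiv.swap_apply_right] at e2
      exact hlt.ne e2
    rw [Equiv.swap_apply_of_ne_of_ne h'.1.ne' hbb] at e2
    exact h.2.2 b' h'.1 (by rw [e2]; exact hlt) (by rw [e2, e1]; exact h'.2.1)
  have e0 : π a = π' a :=
    le_antisymm (not_lt.mp (aux π' π b' b h' h he.symm)) (not_lt.mp (aux π π' b b' h h' he))
  have f1 : (π * Equiv.swap a b) b = π a := by simp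
  have f2 : (π * Equiv.swap a b) b' = π' a := by rw [he]; simp
  exact (π * Equiv.swap a b).injective (by rw [f1, f2, e0])

lemma mProb_filter (n : ℕ) (q : ℝ) (A : Equiv.Perm (Fin n) → Prop) :
    mProb n q A = ∑ π ∈ Finset.univ.filter A, mallowsP n q π := by
  unfold mProb
  rw [Finset.sum_filter]

lemma rank_step (n : ℕ) (q : ℝ) (a : Fin n) (C : Equiv.Perm (Fin n) → Prop)
    (hC : ∀ π b, a < b → C π → C (π * Equiv.swap a b)) (k : ℕ) (hk : k + 1 < n - a) :
    mProb n q (fun π => C π ∧ rk a π = k + 1) = q * mProb n q (fun π => C π ∧ rk a π = k) := by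
  rw [mProb_filter, mProb_filter, Finset.mul_sum]
  symm
  have hup : ∀ π : Equiv.Perm (Fin n), rk a π = k → ∃ b, StepAt π a b := by
    intro π h; exact exists_up π a (by omega)
  haveI : Nonempty (Fin n) := ⟨a⟩
  choose! u hu using hup
  refine Finset.sum_bij (fun π _ => π * Equiv.swap a (u π)) ?_ ?_ ?_ ?_
  · intro π hπ
    simp only [Finset.mem_filter, Finset.mem_univ, true_and] at hπ ⊢
    exact ⟨hC _ _ (hu π hπ.2).1 hπ.1, by rw [step_rk _ _ _ (hu π hπ.2), hπ.2]⟩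
  · intro π hπ π' hπ' he
    simp only [Finset.mem_filter, Finset.mem_univ, true_and] at hπ hπ' he
    have := step_inj π π' a _ _ (hu π hπ.2) (hu π' hπ'.2) he
    rw [this] at he
    exact mul_right_cancel he
  · intro σ hσ
    simp only [Finset.mem_filter, Finset.mem_univ, true_and] at hσ
    obtain ⟨b, hb⟩ := exists_down σ a (by omega)
    have hs : σ * Equiv.swap a b * Equiv.swap a b = σ := by
      rw [mul_assoc, Equiv.swap_mul_self, mul_one]
    have hr := step_rk _ _ _ hb
    rw [hs] at hr
    have hrk : rk a (σ * Equiv.swap a b) = k := by omega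
    refine ⟨σ * Equiv.swap a b, ?_, ?_⟩
    · simp only [Finset.mem_filter, Finset.mem_univ, true_and]
      exact ⟨hC _ _ hb.1 hσ.1, hrk⟩
    · have h1 := hu _ hrk
      have : u (σ * Equiv.swap a b) = b := by
        have hle : ∀ (ρ : Equiv.Perm (Fin n)) (x y : Fin n), StepAt ρ a x → StepAt ρ a y →
            ρ x ≤ ρ y := fun ρ x y hx hy => not_lt.mp (hx.2.2 y hy.1 hy.2.1)
        exact (σ * Equiv.swap a b).injective (le_antisymm (hle _ _ _ h1 hb) (hle _ _ _ hb h1))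
      simp only [this, hs]
  · intro π hπ
    simp only [Finset.mem_filter, Finset.mem_univ, true_and] at hπ
    unfold mallowsP
    rw [step_inv _ _ _ (hu π hπ.2)]
    ring

lemma rank_prob (n : ℕ) (q : ℝ) (h1 : q < 1) (h0 : 0 < q)
    (a : Fin n) (C : Equiv.Perm (Fin n) → Prop)
    (hC : ∀ π b, a < b → C π → C (π * Equiv.swap a b)) (k : ℕ) (hk : k < n - a) :
    mProb n q (fun π => C π ∧ rk a π = k) =
      q ^ k * ((1 - q) / (1 - q ^ (n - (a : ℕ)))) * mProb n q C := by
  have hpow : ∀ k, k < n - (a : ℕ) → mProb n q (fun π => C π ∧ rk a π = k) =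
      q ^ k * mProb n q (fun π => C π ∧ rk a π = 0) := by
    intro k
    induction k with
    | zero => intro _; simp
    | succ k ih =>
      intro hk
      rw [rank_step n q a C hC k hk, ih (by omega)]; ring
  have htot : mProb n q C = ∑ k ∈ Finset.range (n - (a : ℕ)),
      mProb n q (fun π => C π ∧ rk a π = k) := by
    unfold mProb
    rw [Finset.sum_comm]
    refine Finset.sum_congr rfl fun π _ => ?_
    by_cases hc : C π
    · simp [hc, rk_lt π a]
    · simp [hc]
  have hsum : mProb n q C = (∑ k ∈ Finset.range (n - (a : ℕ)), q ^ k) *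
      mProb n q (fun π => C π ∧ rk a π = 0) := by
    rw [htot, Finset.sum_mul]
    exact Finset.sum_congr rfl fun k hk => hpow k (Finset.mem_range.mp hk)
  have hne : 1 - q ^ (n - (a : ℕ)) ≠ 0 := by
    have := pow_lt_one₀ h0.le h1 (n := n - (a : ℕ)) (by omega)
    linarith
  have hgeo : (∑ k ∈ Finset.range (n - (a : ℕ)), q ^ k) * (1 - q) = 1 - q ^ (n - (a : ℕ)) := by
    have := geom_sum_mul q (n - (a : ℕ))
    linarith
  rw [hpow k hk, hsum]
  field_simp
  rw [← hgeo]; ring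

/-- The conditioning event. -/
def Bev (n t : ℕ) (g : Finset (Fin n × Fin n)) (π : Equiv.Perm (Fin n)) : Prop :=
  graphP n π ∩ Finset.univ.filter
    (fun p : Fin n × Fin n => (p.1 : ℕ) < t ∧ (p.2 : ℕ) < t) = g

lemma Bev_iff (n t : ℕ) (g : Finset (Fin n × Fin n)) (π : Equiv.Perm (Fin n)) :
    Bev n t g π ↔ ∀ c d : Fin n, (c, d) ∈ g ↔ (π c = d ∧ (c : ℕ) < t ∧ (d : ℕ) < t) := by
  unfold Bev graphP
  rw [Finset.ext_iff]
  constructor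
  · intro h c d
    rw [← h (c, d)]; simp
  · rintro h ⟨c, d⟩
    rw [h c d]; simp

lemma Bev_inv (n t : ℕ) (g : Finset (Fin n × Fin n)) (π : Equiv.Perm (Fin n)) :
    Bev n t (g.image Prod.swap) π⁻¹ ↔ Bev n t g π := by
  rw [Bev_iff, Bev_iff]
  have hm : ∀ c d : Fin n, (c, d) ∈ g.image Prod.swap ↔ (d, c) ∈ g := by
    intro c d; simp [Prod.swap]
  have hp : ∀ c d : Fin n, π⁻¹ c = d ↔ π d = c := by
    intro c d; rw [Equiv.Perm.inv_eq_iff_eq]; exact eq_comm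
  simp only [hm, hp]
  constructor
  · intro h c d; rw [h d c]; tauto
  · intro h c d; rw [h d c]; tauto

lemma key_col (n : ℕ) (q : ℝ) (h0 : 0 < q) (h1 : q < 1) (a : Fin n)
    (g : Finset (Fin n × Fin n)) (C : Equiv.Perm (Fin n) → Prop)
    (hC : ∀ π b, a < b → C π → C (π * Equiv.swap a b))
    (hCB : ∀ π, C π → Bev n a g π)
    (j : Fin n) (hj : (j : ℕ) < a) (hjf : ∀ p ∈ g, p.2 ≠ j) :
    mProb n q (fun π => π a = j ∧ C π) =
      q ^ ((Finset.univ.filter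
          (fun j' : Fin n => (j' : ℕ) < a ∧ (∀ p ∈ g, p.2 ≠ j') ∧ j' ≤ j)).card - 1) *
        ((1 - q) / (1 - q ^ (n - (a : ℕ)))) * mProb n q C := by
  set S := Finset.univ.filter
          (fun j' : Fin n => (j' : ℕ) < a ∧ (∀ p ∈ g, p.2 ≠ j') ∧ j' ≤ j) with hS
  by_cases hemp : ∀ π, ¬ C π
  · simp [mProb, hemp]
  push Not at hemp
  have hfree : ∀ π, C π → ∀ x : Fin n, (x : ℕ) < a → ((∀ p ∈ g, p.2 ≠ x) ↔ a ≤ π⁻¹ x) := by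
    intro π hπ x hx
    have hB := (Bev_iff _ _ _ _).mp (hCB π hπ)
    constructor
    · intro h
      by_contra hcon
      refine h (π⁻¹ x, x) ((hB _ _).mpr ⟨by simp, ?_, hx⟩) rfl
      exact not_le.mp hcon
    · rintro h ⟨c, d⟩ hp he
      simp only at he
      subst he
      obtain ⟨e, hc, hd⟩ := (hB _ _).mp hp
      have e2 : π⁻¹ d = c := by rw [Equiv.Perm.inv_eq_iff_eq, e]
      rw [e2] at h
      exact absurd hc (not_lt.mpr h)
  have hcard : ∀ π, C π →
      ((Finset.univ : Finset (Fin n)).filter (fun c => a ≤ c ∧ π c < j)).card = S.card - 1 := by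
    intro π hπ
    have hjS : j ∈ S := Finset.mem_filter.mpr ⟨Finset.mem_univ _, hj, hjf, le_rfl⟩
    rw [← Finset.card_erase_of_mem hjS, ← Finset.card_map π.toEmbedding]
    congr 1
    ext x
    simp only [Finset.mem_map_equiv, Finset.mem_filter, Finset.mem_univ, true_and,
      Finset.mem_erase, hS]
    have e : π (π.symm x) = x := by simp
    rw [e]
    have e' : π.symm x = π⁻¹ x := rfl
    rw [e']
    constructor
    · rintro ⟨h1, h2⟩
      have hx : (x : ℕ) < a := lt_trans h2 hj
      exact ⟨h2.ne, hx, (hfree π hπ x hx).mpr h1, h2.le⟩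
    · rintro ⟨h1, h2, h3, h4⟩
      exact ⟨(hfree π hπ x h2).mp h3, lt_of_le_of_ne h4 h1⟩
  have hlt : S.card - 1 < n - (a : ℕ) := by
    obtain ⟨π, hπ⟩ := hemp
    rw [← hcard π hπ]
    have : ((Finset.univ : Finset (Fin n)).filter (fun c => a ≤ c ∧ π c < j)).card <
        (Finset.Ici a).card := by
      apply Finset.card_lt_card
      rw [Finset.ssubset_iff_of_subset]
      · exact ⟨π⁻¹ j, by simpa using (hfree π hπ j hj).mp hjf, by simp⟩
      · intro c; simp; tauto
    rwa [Fin.card_Ici] at this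
  rw [← rank_prob n q h1 h0 a C hC _ hlt]
  unfold mProb
  refine Finset.sum_congr rfl fun π _ => ?_
  congr 1
  beta_reduce
  rw [eq_iff_iff, and_comm]
  refine and_congr_right fun hπ => ?_
  rw [← hcard π hπ]
  unfold rk
  constructor
  · intro e; rw [e]
  · intro e
    by_contra hne
    rcases lt_or_gt_of_ne hne with hl | hl
    · refine absurd e (Finset.card_lt_card ?_).ne
      rw [Finset.ssubset_iff_of_subset]
      · exact ⟨a, by simpa using hl, by simp⟩
      · intro c; simp only [Finset.mem_filter, Finset.mem_univ, true_and]
        exact fun h => ⟨h.1, h.2.trans hl⟩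
    · refine absurd e (Finset.card_lt_card ?_).ne'
      rw [Finset.ssubset_iff_of_subset]
      · exact ⟨π⁻¹ j, by simpa using ⟨(hfree π hπ j hj).mp hjf, hl⟩, by simp⟩
      · intro c; simp only [Finset.mem_filter, Finset.mem_univ, true_and]
        exact fun h => ⟨h.1, h.2.trans hl⟩

lemma invCount_inv (n : ℕ) (π : Equiv.Perm (Fin n)) : invCount n π⁻¹ = invCount n π := by
  unfold invCount
  refine Finset.card_bij' (fun p _ => (π⁻¹ p.2, π⁻¹ p.1)) (fun p _ => (π p.2, π p.1)) ?_ ?_ ?_ ?_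
  · intro p; simp; tauto
  · intro p; simp; tauto
  · intro p; simp
  · intro p; simp

lemma mProb_inv (n : ℕ) (q : ℝ) (A : Equiv.Perm (Fin n) → Prop) :
    mProb n q (fun π => A π⁻¹) = mProb n q A := by
  unfold mProb
  refine Fintype.sum_equiv (Equiv.inv _) _ _ fun π => ?_
  simp [mallowsP, invCount_inv]

lemma Bev_swap (n : ℕ) (a : Fin n) (g : Finset (Fin n × Fin n)) (π : Equiv.Perm (Fin n))
    (b : Fin n) (hab : a < b) (h : Bev n a g π) : Bev n a g (π * Equiv.swap a b) := by
  rw [Bev_iff] at h ⊢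
  intro c d
  rw [h c d]
  have : (c : ℕ) < a → (π * Equiv.swap a b) c = π c := by
    intro hc
    have hc' : c < a := hc
    rw [Equiv.Perm.mul_apply, Equiv.swap_apply_of_ne_of_ne hc'.ne (hc'.trans hab).ne]
  constructor
  · rintro ⟨h1, h2, h3⟩; exact ⟨by rw [this h2, h1], h2, h3⟩
  · rintro ⟨h1, h2, h3⟩; exact ⟨by rw [← this h2, h1], h2, h3⟩

theorem mallows_head_tail_probabilities
    (n : ℕ) (q : ℝ) (h0 : 0 < q) (h1 : q < 1)
    (t : ℕ) (ht : t < n) (g : Finset (Fin n × Fin n))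
    (hg : ∀ p ∈ g, (p.1 : ℕ) < t ∧ (p.2 : ℕ) < t)
    (hpos : 0 < mProb n q (fun π =>
      graphP n π ∩
        Finset.univ.filter
          (fun p : Fin n × Fin n => (p.1 : ℕ) < t ∧ (p.2 : ℕ) < t) = g)) :
    -- (a) probability that the next value `π(t+1)` equals a free column value `j`
    (∀ j : Fin n, (j : ℕ) < t → (∀ p ∈ g, p.2 ≠ j) →
      ∀ k : ℕ,
        k = (Finset.univ.filter
          (fun j' : Fin n => (j' : ℕ) < t ∧ (∀ p ∈ g, p.2 ≠ j') ∧ j' ≤ j)).card →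
        mCondProb n q (fun π => π ⟨t, ht⟩ = j)
            (fun π => graphP n π ∩
              Finset.univ.filter
                (fun p : Fin n × Fin n => (p.1 : ℕ) < t ∧ (p.2 : ℕ) < t) = g)
          = q ^ (k - 1) * ((1 - q) / (1 - q ^ (n - t)))) ∧
    -- (b) probability that a free row index `i` is mapped to value `t+1`
    (∀ i : Fin n, (i : ℕ) < t → (∀ p ∈ g, p.1 ≠ i) →
      ∀ k' : ℕ,
        k' = (Finset.univ.filter
          (fun i' : Fin n => (i' : ℕ) < t ∧ (∀ p ∈ g, p.1 ≠ i') ∧ i' ≤ i)).card →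
        mCondProb n q (fun π => π i = ⟨t, ht⟩)
            (fun π => graphP n π ∩
              Finset.univ.filter
                (fun p : Fin n × Fin n => (p.1 : ℕ) < t ∧ (p.2 : ℕ) < t) = g)
          = q ^ (k' - 1) * ((1 - q) / (1 - q ^ (n - t)))) ∧
    -- (c) conditional independence of the two events
    (∀ i j : Fin n, (i : ℕ) < t → (∀ p ∈ g, p.1 ≠ i) →
      (j : ℕ) < t → (∀ p ∈ g, p.2 ≠ j) →
      mCondProb n q (fun π => π i = ⟨t, ht⟩ ∧ π ⟨t, ht⟩ = j)
          (fun π => graphP n π ∩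
            Finset.univ.filter
              (fun p : Fin n × Fin n => (p.1 : ℕ) < t ∧ (p.2 : ℕ) < t) = g)
        =
        mCondProb n q (fun π => π i = ⟨t, ht⟩)
            (fun π => graphP n π ∩
              Finset.univ.filter
                (fun p : Fin n × Fin n => (p.1 : ℕ) < t ∧ (p.2 : ℕ) < t) = g) *
        mCondProb n q (fun π => π ⟨t, ht⟩ = j)
            (fun π => graphP n π ∩
              Finset.univ.filter
                (fun p : Fin n × Fin n => (p.1 : ℕ) < t ∧ (p.2 : ℕ) < t) = g)) := by
  change 0 < mProb n q (Bev n t g) at hpos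
  have hA : ∀ (g : Finset (Fin n × Fin n)) (j : Fin n), (j : ℕ) < t → (∀ p ∈ g, p.2 ≠ j) →
      0 < mProb n q (Bev n t g) →
      mCondProb n q (fun π => π ⟨t, ht⟩ = j) (Bev n t g) =
        q ^ ((Finset.univ.filter
          (fun j' : Fin n => (j' : ℕ) < t ∧ (∀ p ∈ g, p.2 ≠ j') ∧ j' ≤ j)).card - 1) *
        ((1 - q) / (1 - q ^ (n - t))) := by
    intro g j hj hjf hpos
    have := key_col n q h0 h1 ⟨t, ht⟩ g (Bev n t g)
      (fun π b hb h => Bev_swap n ⟨t, ht⟩ g π b hb h) (fun π h => h) j hj hjf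
    unfold mCondProb
    rw [this, mul_div_assoc, div_self hpos.ne', mul_one]
  refine ⟨?_, ?_, ?_⟩
  · rintro j hj hjf k rfl
    exact hA g j hj hjf hpos
  · rintro i hi hif k rfl
    change mCondProb n q _ (Bev n t g) = _
    have hBi : mProb n q (Bev n t (g.image Prod.swap)) = mProb n q (Bev n t g) := by
      rw [← mProb_inv]; simp only [Bev_inv]
    have hfr : ∀ x : Fin n, (∀ p ∈ g.image Prod.swap, p.2 ≠ x) ↔ (∀ p ∈ g, p.1 ≠ x) := by
      intro x; simp only [Finset.forall_mem_image, Prod.snd_swap]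
    have h2 := hA (g.image Prod.swap) i hi ((hfr i).mpr hif) (by rw [hBi]; exact hpos)
    simp only [hfr] at h2
    rw [← h2]
    unfold mCondProb
    rw [hBi, ← mProb_inv n q (fun π => π ⟨t, ht⟩ = i ∧ Bev n t (g.image Prod.swap) π)]
    simp only [Bev_inv]
    congr 2
    ext π
    rw [Equiv.Perm.inv_eq_iff_eq, eq_comm]
  · intro i j hi hif hj hjf
    change mCondProb n q _ (Bev n t g) = mCondProb n q _ (Bev n t g) * mCondProb n q _ (Bev n t g)
    rw [hA g j hj hjf hpos]
    have h3 := key_col n q h0 h1 ⟨t, ht⟩ g (fun π => π i = ⟨t, ht⟩ ∧ Bev n t g π)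
      (fun π b hb h => ⟨by
        have hi' : i < (⟨t, ht⟩ : Fin n) := hi
        rw [Equiv.Perm.mul_apply, Equiv.swap_apply_of_ne_of_ne hi'.ne (hi'.trans hb).ne]
        exact h.1, Bev_swap n ⟨t, ht⟩ g π b hb h.2⟩) (fun π h => h.2) j hj hjf
    unfold mCondProb
    have h4 : mProb n q (fun π => (π i = ⟨t, ht⟩ ∧ π ⟨t, ht⟩ = j) ∧ Bev n t g π) =
        mProb n q (fun π => π ⟨t, ht⟩ = j ∧ π i = ⟨t, ht⟩ ∧ Bev n t g π) := by
      congr 1; ext π; tauto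
    rw [h4, h3]
    ring
end
end

section
/- Let n ≥ 1 be an integer, 0 < q < 1, and let π have the Mallows distribution μ_{n,q}. Let 1 ≤ s ≤ n and let g ⊆ {1,…,s−1}² be any set with P[Γ_π ∩ ({1,…,s−1}×{1,…,s−1}) = g] > 0, and set k := (s−1) − |g| (so κ_{s−1}(π) = k on the conditioning event). Then q^k · (1−q)/(1−q^{n−s+1}) ≤ P[s = max(C_s(π)) | Γ_π ∩ ({1,…,s−1}×{1,…,s−1}) = g] ≤ (1−q)/(1−q^{n−s+1}). -/
open Finset
open scoped Classical BigOperators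

noncomputable section

/-- The set of points of the cycle of `π` containing `s`. -/
def cycleSet (n : ℕ) (π : Equiv.Perm (Fin n)) (s : Fin n) : Finset (Fin n) :=
  Finset.univ.filter (fun t => π.SameCycle s t)

lemma self_mem_cycleSet (n : ℕ) (π : Equiv.Perm (Fin n)) (s : Fin n) :
    s ∈ cycleSet n π s :=
  Finset.mem_filter.mpr ⟨Finset.mem_univ _, Equiv.Perm.SameCycle.refl _ _⟩

/-- Maximal element of the cycle of `s`, in 1-indexed labelling `{1,…,n}`. -/
def cycMax (n : ℕ) (π : Equiv.Perm (Fin n)) (s : Fin n) : ℕ :=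
  (cycleSet n π s).sup (fun t => (t : ℕ) + 1)

/-- Minimal element of the cycle of `s`, in 1-indexed labelling `{1,…,n}`. -/
def cycMin (n : ℕ) (π : Equiv.Perm (Fin n)) (s : Fin n) : ℕ :=
  (cycleSet n π s).inf' ⟨s, self_mem_cycleSet n π s⟩ (fun t => (t : ℕ) + 1)

lemma invCount_swap (n : ℕ) (σ : Equiv.Perm (Fin n)) (a b : Fin n) (hab : a < b)
    (hs : σ a < σ b) (hm : ∀ c, a < c → c < b → σ c < σ a) :
    invCount n (σ * Equiv.swap a b) = invCount n σ + 1 := by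
  unfold invCount
  set I := (Finset.univ : Finset (Fin n × Fin n)).filter
    (fun p => p.1 < p.2 ∧ σ p.2 < σ p.1) with hI
  set I' := (Finset.univ : Finset (Fin n × Fin n)).filter
    (fun p => p.1 < p.2 ∧ (σ * Equiv.swap a b) p.2 < (σ * Equiv.swap a b) p.1) with hI'
  have hmem : (a, b) ∈ I' := by
    rw [hI', Finset.mem_filter]
    simpa using ⟨hab, hs⟩
  rw [← Finset.card_erase_add_one hmem]
  congr 1
  let Φ : Fin n × Fin n → Fin n × Fin n := fun p =>
    if (a < p.1 ∧ p.1 < b) ∨ (a < p.2 ∧ p.2 < b) then p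
    else (Equiv.swap a b p.1, Equiv.swap a b p.2)
  have hinv : ∀ p, Φ (Φ p) = p := by
    rintro ⟨x, y⟩
    simp only [Φ, Equiv.swap_apply_def]
    grind
  refine Finset.card_bij' (fun p _ => Φ p) (fun p _ => Φ p) ?_ ?_ (fun p _ => hinv p)
    (fun p _ => hinv p)
  · rintro ⟨x, y⟩ h
    simp only [hI, hI', Finset.mem_erase, Finset.mem_filter, Finset.mem_univ, true_and,
      Equiv.Perm.mul_apply, Equiv.swap_apply_def, Φ] at h ⊢
    grind
  · rintro ⟨x, y⟩ h
    simp only [hI, hI', Finset.mem_erase, Finset.mem_filter, Finset.mem_univ, true_and,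
      Equiv.Perm.mul_apply, Equiv.swap_apply_def, Φ] at h ⊢
    have hx := hm x
    have hy := hm y
    grind

/-- The rows with small values. -/
def keyF (n t : ℕ) (ht : t < n) (π : Equiv.Perm (Fin n)) : Fin n → Fin n :=
  fun x => min (π x) ⟨t, ht⟩

lemma keyF_small {n t : ℕ} {ht : t < n} {π π0 : Equiv.Perm (Fin n)}
    (h : keyF n t ht π = keyF n t ht π0) (x : Fin n) (hx : (π0 x : ℕ) < t) : π x = π0 x := by
  have := congrFun h x
  simp only [keyF] at this
  have h2 : π0 x < ⟨t, ht⟩ := hx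
  grind

lemma keyF_large {n t : ℕ} {ht : t < n} {π π0 : Equiv.Perm (Fin n)}
    (h : keyF n t ht π = keyF n t ht π0) (x : Fin n) (hx : t ≤ (π0 x : ℕ)) : t ≤ (π x : ℕ) := by
  have := congrFun h x
  simp only [keyF] at this
  have h2 : ⟨t, ht⟩ ≤ π0 x := hx
  have h3 : ⟨t, ht⟩ ≤ π x := by grind
  exact h3

lemma fiber_sum (n : ℕ) (q : ℝ) (h1 : q < 1) (t : ℕ) (ht : t < n)
    (π0 : Equiv.Perm (Fin n)) (r : Fin n) (hr : t ≤ (π0 r : ℕ)) :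
    ∃ c : ℕ, c ≤ ((Finset.univ : Finset (Fin n)).filter
        (fun x => t ≤ (π0 x : ℕ) ∧ x < r)).card ∧
      (∑ π ∈ Finset.univ.filter (fun π => keyF n t ht π = keyF n t ht π0),
        if π r = ⟨t, ht⟩ then q ^ invCount n π else 0) * (1 - q ^ (n - t)) = 
      q ^ c * (1 - q) * ∑ π ∈ Finset.univ.filter (fun π => keyF n t ht π = keyF n t ht π0),
        q ^ invCount n π := by
  set F := (Finset.univ : Finset (Equiv.Perm (Fin n))).filter
    (fun π => keyF n t ht π = keyF n t ht π0) with hF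
  set R := (Finset.univ : Finset (Fin n)).filter (fun x => t ≤ (π0 x : ℕ)) with hR
  have hcard : R.card = n - t := by
    have : R = (Finset.Ici (⟨t, ht⟩ : Fin n)).map π0.symm.toEmbedding := by
      ext x
      simp only [hR, Finset.mem_filter, Finset.mem_univ, true_and, Finset.mem_map_equiv,
        Finset.mem_Ici, Equiv.symm_symm]
      rfl
    rw [this, Finset.card_map, Fin.card_Ici]
  let e := R.orderEmbOfFin hcard
  have heR : ∀ i, e i ∈ R := fun i => Finset.orderEmbOfFin_mem R hcard i
  have hsurj : ∀ x ∈ R, ∃ i, e i = x := by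
    intro x hx
    have := Finset.range_orderEmbOfFin R hcard
    have hx' : x ∈ Set.range (R.orderEmbOfFin hcard) := by rw [this]; exact hx
    exact hx'
  let W : Fin (n - t) → ℝ := fun i => ∑ π ∈ F, if π (e i) = ⟨t, ht⟩ then q ^ invCount n π else 0
  have hstep : ∀ i j : Fin (n - t), (j : ℕ) = i + 1 → W j = q * W i := by
    intro i j hij
    simp only [W]
    rw [Finset.mul_sum]
    symm
    have hne : e i < e j := e.strictMono (by rw [Fin.lt_def]; omega)
    have hkey : ∀ π ∈ F, π * Equiv.swap (e i) (e j) ∈ F := by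
      intro π hπ
      simp only [hF, Finset.mem_filter, Finset.mem_univ, true_and] at hπ ⊢
      rw [← hπ]
      have hi := keyF_large hπ (e i) (by simpa [hR] using heR i)
      have hj := keyF_large hπ (e j) (by simpa [hR] using heR j)
      have hi' : ⟨t, ht⟩ ≤ π (e i) := hi
      have hj' : ⟨t, ht⟩ ≤ π (e j) := hj
      funext x
      simp only [keyF, Equiv.Perm.mul_apply, Equiv.swap_apply_def]
      grind
    refine Finset.sum_bij' (fun π _ => π * Equiv.swap (e i) (e j))
      (fun π _ => π * Equiv.swap (e i) (e j)) hkey hkey ?_ ?_ ?_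
    · intro π _; simp [mul_assoc]
    · intro π _; simp [mul_assoc]
    · intro π hπ
      simp only [Equiv.Perm.mul_apply, Equiv.swap_apply_right]
      by_cases h : π (e i) = ⟨t, ht⟩
      · rw [if_pos h, if_pos h]
        have hπ' : keyF n t ht π = keyF n t ht π0 := by simpa [hF] using hπ
        rw [invCount_swap n π (e i) (e j) hne, pow_succ, mul_comm]
        · rw [h]
          have hj := keyF_large hπ' (e j) (by simpa [hR] using heR j)
          refine lt_of_le_of_ne hj ?_
          rw [← h]
          exact fun h' => hne.ne (π.injective h')
        · intro c hc1 hc2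
          have hcR : c ∉ R := by
            intro hc
            obtain ⟨l, rfl⟩ := hsurj c hc
            have a1 := e.lt_iff_lt.1 hc1
            have a2 := e.lt_iff_lt.1 hc2
            rw [Fin.lt_def] at a1 a2
            omega
          have hc0 : (π0 c : ℕ) < t := by simpa [hR] using hcR
          rw [keyF_small hπ' c hc0, h]
          exact hc0
      · rw [if_neg h, if_neg h, mul_zero]
  have hmpos : 0 < n - t := by omega
  have hW : ∀ (i : ℕ) (hi : i < n - t), W ⟨i, hi⟩ = q ^ i * W ⟨0, hmpos⟩ := by
    intro i
    induction i with
    | zero => intro hi; simp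
    | succ i ih =>
      intro hi
      rw [hstep ⟨i, by omega⟩ ⟨i+1, hi⟩ rfl, ih (by omega), pow_succ]; ring
  have hT : ∑ π ∈ F, q ^ invCount n π = ∑ i, W i := by
    simp only [W]
    rw [Finset.sum_comm]
    refine Finset.sum_congr rfl fun π hπ => ?_
    have hπ' : keyF n t ht π0 = keyF n t ht π := by
      have : keyF n t ht π = keyF n t ht π0 := by simpa [hF] using hπ
      exact this.symm
    have hx : π.symm ⟨t, ht⟩ ∈ R := by
      have := keyF_large hπ' (π.symm ⟨t, ht⟩) (by simp)
      simpa [hR] using this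
    obtain ⟨i, hi⟩ := hsurj _ hx
    rw [Finset.sum_eq_single i]
    · rw [hi]; simp
    · intro j _ hj
      rw [if_neg]
      intro h
      apply hj
      apply e.injective
      rw [hi, ← h]; simp
    · simp
  obtain ⟨i, hi⟩ := hsurj r (by simpa [hR] using hr)
  refine ⟨i, ?_, ?_⟩
  · calc (i : ℕ) = ((Finset.Iio i).map e.toEmbedding).card := by simp
      _ ≤ _ := by
        apply Finset.card_le_card
        intro x hx
        simp only [Finset.mem_map, Finset.mem_Iio] at hx
        obtain ⟨l, hl, rfl⟩ := hx
        simp only [Finset.mem_filter, Finset.mem_univ, true_and]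
        refine ⟨by simpa [hR] using heR l, ?_⟩
        rw [← hi]
        exact e.strictMono hl
  · rw [hT]
    have h3 : (∑ π ∈ F, if π r = ⟨t, ht⟩ then q ^ invCount n π else 0) = W i := by
      simp only [W, hi]
    have h4 : ∑ i, W i = (∑ i ∈ Finset.range (n - t), q ^ i) * W ⟨0, hmpos⟩ := by
      rw [Finset.sum_mul, ← Fin.sum_univ_eq_sum_range (fun i => q ^ i * W ⟨0, hmpos⟩)]
      exact Finset.sum_congr rfl fun i _ => hW i i.2
    rw [h3, h4, hW i i.2, ← mul_neg_geom_sum q (n - t)]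
    ring

lemma exists_row (n t : ℕ) (ht : t < n) (π0 : Equiv.Perm (Fin n)) :
    ∃ r : Fin n, (r : ℕ) ≤ t ∧ t ≤ (π0 r : ℕ) ∧ ∀ π : Equiv.Perm (Fin n),
      keyF n t ht π = keyF n t ht π0 → (cycMax n π ⟨t, ht⟩ = t + 1 ↔ π r = ⟨t, ht⟩) := by
  have hex : ∃ i : ℕ, t ≤ ((π0 ^ (i + 1)) ⟨t, ht⟩ : ℕ) := by
    refine ⟨orderOf π0 - 1, ?_⟩
    have : orderOf π0 - 1 + 1 = orderOf π0 := Nat.sub_add_cancel (orderOf_pos π0)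
    rw [this, pow_orderOf_eq_one]; simp
  set i := Nat.find hex with hi
  have hspec := Nat.find_spec hex
  have hmin : ∀ j < i, ((π0 ^ (j + 1)) ⟨t, ht⟩ : ℕ) < t := fun j hj => by
    have := Nat.find_min hex hj
    omega
  have hle : ∀ j ≤ i, ((π0 ^ j) ⟨t, ht⟩ : ℕ) ≤ t := by
    intro j hj
    cases j with
    | zero => simp
    | succ j => exact (hmin j (by omega)).le
  have hs : t ≤ (π0 ((π0 ^ i) ⟨t, ht⟩) : ℕ) := by
    rw [← Equiv.Perm.mul_apply, ← pow_succ']; exact hspec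
  refine ⟨(π0 ^ i) ⟨t, ht⟩, hle i le_rfl, hs, ?_⟩
  intro π hπ
  have hpow : ∀ j ≤ i, (π ^ j) ⟨t, ht⟩ = (π0 ^ j) ⟨t, ht⟩ := by
    intro j
    induction j with
    | zero => intro _; rfl
    | succ j ih =>
      intro hj
      have h := hmin j (by omega)
      rw [pow_succ', Equiv.Perm.mul_apply] at h ⊢
      rw [pow_succ', Equiv.Perm.mul_apply, ih (by omega)]
      exact keyF_small hπ _ h
  have hmax : cycMax n π ⟨t, ht⟩ = t + 1 ↔ ∀ y, π.SameCycle ⟨t, ht⟩ y → (y : ℕ) ≤ t := by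
    unfold cycMax
    constructor
    · intro h y hy
      have : (y : ℕ) + 1 ≤ (cycleSet n π ⟨t, ht⟩).sup (fun t => (t : ℕ) + 1) :=
        Finset.le_sup (f := fun t : Fin n => (t : ℕ) + 1)
          (Finset.mem_filter.mpr ⟨Finset.mem_univ _, hy⟩)
      omega
    · intro h
      apply le_antisymm
      · apply Finset.sup_le
        intro y hy
        have := h y (Finset.mem_filter.mp hy).2
        omega
      · exact Finset.le_sup (f := fun t : Fin n => (t : ℕ) + 1)
          (self_mem_cycleSet n π ⟨t, ht⟩)
  rw [hmax]
  constructor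
  · intro h
    apply Fin.ext
    apply le_antisymm
    · apply h
      rw [← hpow i le_rfl, ← Equiv.Perm.mul_apply, ← pow_succ']
      exact ⟨(i + 1 : ℕ), by simp only [zpow_natCast]⟩
    · exact keyF_large hπ _ hs
  · intro h y hy
    obtain ⟨N, -, rfl⟩ := hy.exists_pow_eq'
    have hper : (π ^ (i + 1)) ⟨t, ht⟩ = ⟨t, ht⟩ := by
      rw [pow_succ', Equiv.Perm.mul_apply, hpow i le_rfl, h]
    have hmod : ∀ N : ℕ, (((π ^ N) ⟨t, ht⟩ : Fin n) : ℕ) ≤ t := by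
      intro N
      induction N using Nat.strong_induction_on with
      | _ N ih =>
        by_cases hN : N ≤ i
        · rw [hpow N hN]; exact hle N hN
        · obtain ⟨M, rfl⟩ : ∃ M, N = M + (i + 1) := ⟨N - (i + 1), by omega⟩
          rw [pow_add, Equiv.Perm.mul_apply, hper]
          exact ih M (by omega)
    exact hmod N

lemma graph_key {n t : ℕ} {ht : t < n} {π π0 : Equiv.Perm (Fin n)}
    (h : keyF n t ht π = keyF n t ht π0) :
    graphP n π ∩ Finset.univ.filter
        (fun p : Fin n × Fin n => (p.1 : ℕ) < t ∧ (p.2 : ℕ) < t) =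
      graphP n π0 ∩ Finset.univ.filter
        (fun p : Fin n × Fin n => (p.1 : ℕ) < t ∧ (p.2 : ℕ) < t) := by
  ext ⟨x, y⟩
  simp only [graphP, Finset.mem_inter, Finset.mem_filter, Finset.mem_univ, true_and]
  constructor
  · rintro ⟨rfl, h2, h3⟩
    exact ⟨keyF_small h.symm x h3, h2, h3⟩
  · rintro ⟨rfl, h2, h3⟩
    exact ⟨keyF_small h x h3, h2, h3⟩

lemma open_card {n t : ℕ} (ht : t < n) (π0 : Equiv.Perm (Fin n)) :
    ((Finset.univ : Finset (Fin n)).filter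
        (fun x : Fin n => t ≤ (π0 x : ℕ) ∧ (x : ℕ) < t)).card =
      t - (graphP n π0 ∩ Finset.univ.filter
        (fun p : Fin n × Fin n => (p.1 : ℕ) < t ∧ (p.2 : ℕ) < t)).card := by
  have h1 : (graphP n π0 ∩ Finset.univ.filter
        (fun p : Fin n × Fin n => (p.1 : ℕ) < t ∧ (p.2 : ℕ) < t)) =
      ((Finset.univ : Finset (Fin n)).filter
        (fun x : Fin n => (x : ℕ) < t ∧ (π0 x : ℕ) < t)).image (fun x => (x, π0 x)) := by
    ext ⟨x, y⟩
    simp only [graphP, Finset.mem_inter, Finset.mem_filter, Finset.mem_univ, true_and,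
      Finset.mem_image, Prod.mk.injEq]
    constructor
    · rintro ⟨rfl, h⟩; exact ⟨x, h, rfl, rfl⟩
    · rintro ⟨x, h, rfl, rfl⟩; exact ⟨rfl, h⟩
  rw [h1, Finset.card_image_of_injective _ (fun x y h => (Prod.mk.inj h).1)]
  have h2 : ((Finset.univ : Finset (Fin n)).filter (fun x : Fin n => (x : ℕ) < t)).card = t := by
    have : (Finset.univ : Finset (Fin n)).filter (fun x : Fin n => (x : ℕ) < t)
        = Finset.Iio (⟨t, ht⟩ : Fin n) := by
      ext x; simp [Fin.lt_def]
    rw [this, Fin.card_Iio]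
  have h3 := Finset.card_filter_add_card_filter_not
    (s := (Finset.univ : Finset (Fin n)).filter (fun x : Fin n => (x : ℕ) < t))
    (fun x : Fin n => (π0 x : ℕ) < t)
  rw [Finset.filter_filter, Finset.filter_filter, h2] at h3
  have h4 : (Finset.univ : Finset (Fin n)).filter (fun x : Fin n => t ≤ (π0 x : ℕ) ∧ (x : ℕ) < t)
      = (Finset.univ : Finset (Fin n)).filter (fun x : Fin n => (x : ℕ) < t ∧ ¬ (π0 x : ℕ) < t) := by
    ext x; simp [and_comm]
  rw [h4]
  omega

lemma fiber_bounds (n : ℕ) (q : ℝ) (h0 : 0 < q) (h1 : q < 1)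
    (t : ℕ) (ht : t < n) (g : Finset (Fin n × Fin n)) (κ : Fin n → Fin n)
    (A B : Equiv.Perm (Fin n) → Prop)
    (hA : A = fun π => cycMax n π ⟨t, ht⟩ = t + 1)
    (hB : B = fun π => graphP n π ∩ Finset.univ.filter
              (fun p : Fin n × Fin n => (p.1 : ℕ) < t ∧ (p.2 : ℕ) < t) = g) :
    q ^ (t - g.card) * ((1 - q) / (1 - q ^ (n - t))) *
        (∑ π ∈ Finset.univ.filter (fun π => keyF n t ht π = κ),
          if B π then q ^ invCount n π else 0) ≤
      (∑ π ∈ Finset.univ.filter (fun π => keyF n t ht π = κ),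
          if A π ∧ B π then q ^ invCount n π else 0) ∧
    (∑ π ∈ Finset.univ.filter (fun π => keyF n t ht π = κ),
          if A π ∧ B π then q ^ invCount n π else 0) ≤ 
      ((1 - q) / (1 - q ^ (n - t))) *
        (∑ π ∈ Finset.univ.filter (fun π => keyF n t ht π = κ),
          if B π then q ^ invCount n π else 0) := by
  by_cases hne : ∃ π0, keyF n t ht π0 = κ ∧ B π0
  · obtain ⟨π0, rfl, hB0⟩ := hne
    obtain ⟨r, hrt, hr, hrow⟩ := exists_row n t ht π0
    obtain ⟨c, hc, hsum⟩ := fiber_sum n q h1 t ht π0 r hr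
    have hBall : ∀ π, keyF n t ht π = keyF n t ht π0 → B π := by
      intro π hπ
      rw [hB] at hB0 ⊢
      exact (graph_key hπ).trans hB0
    have hck : c ≤ t - g.card := by
      have hB0' := hB0
      rw [hB] at hB0'
      rw [← hB0', ← open_card ht π0]
      refine hc.trans (Finset.card_le_card ?_)
      intro x hx
      simp only [Finset.mem_filter, Finset.mem_univ, true_and] at hx ⊢
      exact ⟨hx.1, lt_of_lt_of_le hx.2 hrt⟩
    have e1 : (∑ π ∈ Finset.univ.filter (fun π => keyF n t ht π = keyF n t ht π0),
          if B π then q ^ invCount n π else 0) =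
        ∑ π ∈ Finset.univ.filter (fun π => keyF n t ht π = keyF n t ht π0),
          q ^ invCount n π := by
      refine Finset.sum_congr rfl fun π hπ => ?_
      rw [if_pos (hBall π (Finset.mem_filter.mp hπ).2)]
    have e2 : (∑ π ∈ Finset.univ.filter (fun π => keyF n t ht π = keyF n t ht π0),
          if A π ∧ B π then q ^ invCount n π else 0) =
        ∑ π ∈ Finset.univ.filter (fun π => keyF n t ht π = keyF n t ht π0),
          if π r = ⟨t, ht⟩ then q ^ invCount n π else 0 := by
      refine Finset.sum_congr rfl fun π hπ => ?_
      have hπ' := (Finset.mem_filter.mp hπ).2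
      have : (A π ∧ B π) ↔ π r = ⟨t, ht⟩ := by
        rw [← hrow π hπ', hA]
        exact and_iff_left (hBall π hπ')
      simp only [this]
    rw [e1, e2]
    have hT : 0 ≤ ∑ π ∈ Finset.univ.filter (fun π => keyF n t ht π = keyF n t ht π0),
          q ^ invCount n π := Finset.sum_nonneg fun π _ => (pow_pos h0 _).le
    generalize (∑ π ∈ Finset.univ.filter (fun π => keyF n t ht π = keyF n t ht π0),
          q ^ invCount n π) = T at *
    generalize (∑ π ∈ Finset.univ.filter (fun π => keyF n t ht π = keyF n t ht π0),
          if π r = ⟨t, ht⟩ then q ^ invCount n π else 0) = N at *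
    have hd : 0 < 1 - q ^ (n - t) := by
      have := pow_lt_one₀ h0.le h1 (show n - t ≠ 0 by omega)
      linarith
    have hN : N = q ^ c * ((1 - q) / (1 - q ^ (n - t)) * T) := by
      field_simp
      linarith
    have hpT : 0 ≤ (1 - q) / (1 - q ^ (n - t)) * T :=
      mul_nonneg (div_nonneg (by linarith) hd.le) hT
    rw [hN]
    constructor
    · rw [mul_assoc]
      exact mul_le_mul_of_nonneg_right (pow_le_pow_of_le_one h0.le h1.le hck) hpT
    · exact mul_le_of_le_one_left hpT (pow_le_one₀ h0.le h1.le)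
  · push Not at hne
    have e1 : (∑ π ∈ Finset.univ.filter (fun π => keyF n t ht π = κ),
          if B π then q ^ invCount n π else 0) = 0 :=
      Finset.sum_eq_zero fun π hπ => if_neg (hne π (Finset.mem_filter.mp hπ).2)
    have e2 : (∑ π ∈ Finset.univ.filter (fun π => keyF n t ht π = κ),
          if A π ∧ B π then q ^ invCount n π else 0) = 0 :=
      Finset.sum_eq_zero fun π hπ => if_neg fun h => hne π (Finset.mem_filter.mp hπ).2 h.2
    rw [e1, e2]
    simp

lemma mProb_eq (n t : ℕ) (ht : t < n) (q : ℝ) (A : Equiv.Perm (Fin n) → Prop) :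
    mProb n q A = (∑ κ : Fin n → Fin n,
      ∑ π ∈ Finset.univ.filter (fun π => keyF n t ht π = κ),
        if A π then q ^ invCount n π else 0) / mallowsZ n q := by
  rw [Finset.sum_fiberwise, Finset.sum_div]
  unfold mProb mallowsP
  refine Finset.sum_congr rfl fun π _ => ?_
  split_ifs <;> simp

theorem mallows_cycle_max_probability_bounds
    (n : ℕ) (q : ℝ) (h0 : 0 < q) (h1 : q < 1)
    (t : ℕ) (ht : t < n) (g : Finset (Fin n × Fin n))
    (hg : ∀ p ∈ g, (p.1 : ℕ) < t ∧ (p.2 : ℕ) < t)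
    (hpos : 0 < mProb n q (fun π =>
      graphP n π ∩
        Finset.univ.filter
          (fun p : Fin n × Fin n => (p.1 : ℕ) < t ∧ (p.2 : ℕ) < t) = g))
    (k : ℕ) (hk : k = t - g.card) :
    q ^ k * ((1 - q) / (1 - q ^ (n - t)))
        ≤ mCondProb n q (fun π => cycMax n π ⟨t, ht⟩ = t + 1)
            (fun π => graphP n π ∩
              Finset.univ.filter
                (fun p : Fin n × Fin n => (p.1 : ℕ) < t ∧ (p.2 : ℕ) < t) = g) ∧
      mCondProb n q (fun π => cycMax n π ⟨t, ht⟩ = t + 1)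
          (fun π => graphP n π ∩
            Finset.univ.filter
              (fun p : Fin n × Fin n => (p.1 : ℕ) < t ∧ (p.2 : ℕ) < t) = g)
        ≤ (1 - q) / (1 - q ^ (n - t)) := by
  subst hk
  have hZ : 0 < mallowsZ n q :=
    Finset.sum_pos (fun _ _ => pow_pos h0 _) ⟨1, Finset.mem_univ _⟩
  have key := fun κ => fiber_bounds n q h0 h1 t ht g κ _ _ rfl rfl
  unfold mCondProb
  rw [le_div_iff₀ hpos, div_le_iff₀ hpos]
  rw [mProb_eq n t ht, mProb_eq n t ht]
  constructor
  · rw [← mul_div_assoc (q ^ (t - g.card) * ((1 - q) / (1 - q ^ (n - t)))) _ (mallowsZ n q),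
      Finset.mul_sum]
    exact div_le_div_of_nonneg_right (Finset.sum_le_sum fun κ _ => by convert (key κ).1; rfl) hZ.le
  · rw [← mul_div_assoc ((1 - q) / (1 - q ^ (n - t))) _ (mallowsZ n q), Finset.mul_sum]
    exact div_le_div_of_nonneg_right (Finset.sum_le_sum fun κ _ => by convert (key κ).2; rfl) hZ.le
end
end
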